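/- arXiv:1811.05203 — 2 statements merged into one kernel-verified Lean document; each statement's English description precedes it below -/
import Mathlib

section
/- Let (G,+) be a finite Abelian group with |G| = q ≥ 2, let 0 ≤ ε ≤ 1, and let W : G → 𝒴 be a channel equivalent to qEC(ε). If W satisfies the background polarization property, then W strongly polarizes: for every δ > 0, lim_{n→∞} 2^{−n}·|{s ∈ {−,+}ⁿ : W^s is δ-determined by {0} or W^s is δ-determined by G}| = 1. -/
open scoped Classical

noncomputable section

universe u v

/-- A (discrete memoryless) channel with input alphabet `X` and finite output alphabet `Y`:
nonnegative entries and each row sums to `1`. -/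
def IsChannel {X : Type*} {Y : Type*} [Fintype Y] (W : X → Y → ℝ) : Prop :=
  (∀ x y, 0 ≤ W x y) ∧ ∀ x, ∑ y, W x y = 1

/-- The symmetric capacity of a channel: the mutual information between a uniformly
distributed input and the corresponding output (terms with `W x y = 0` vanish). -/
def capacity {X : Type*} {Y : Type*} [Fintype X] [Fintype Y] (W : X → Y → ℝ) : ℝ :=
  ∑ y : Y, ∑ x : X, (1 / (Fintype.card X : ℝ)) * W x y *
    Real.log (W x y / ((1 / (Fintype.card X : ℝ)) * ∑ x' : X, W x' y))

/-- The quotient channel `W[H] : G ⧸ H → Y`, `W[H](y|A) = (1/|H|) ∑_{x ∈ A} W(y|x)`. -/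
def quotientChannel {G : Type*} [AddCommGroup G] [Fintype G] (H : AddSubgroup G)
    {Y : Type*} (W : G → Y → ℝ) : G ⧸ H → Y → ℝ :=
  fun A y => (1 / (Nat.card H : ℝ)) * ∑ x : G, if (x : G ⧸ H) = A then W x y else 0

/-- `W` is `δ`-determined by the subgroup `H`:
`|I(W) − log|G/H|| < δ` and `|I(W[H]) − log|G/H|| < δ`. -/
def DeterminedBy {G : Type*} [AddCommGroup G] [Fintype G] {Y : Type*} [Fintype Y]
    (W : G → Y → ℝ) (H : AddSubgroup G) (δ : ℝ) : Prop :=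
  |capacity W - Real.log (Nat.card (G ⧸ H))| < δ ∧
  |capacity (quotientChannel H W) - Real.log (Nat.card (G ⧸ H))| < δ

/-- The "minus" Arıkan transform `W⁻(y₁,y₂|u₁) = (1/q) ∑_{u₂} W(y₁|u₁+u₂) W(y₂|u₂)`. -/
def minusChannel {G : Type*} [AddCommGroup G] [Fintype G] {Y : Type*}
    (W : G → Y → ℝ) : G → Y × Y → ℝ :=
  fun u₁ y => (1 / (Fintype.card G : ℝ)) * ∑ u₂ : G, W (u₁ + u₂) y.1 * W u₂ y.2

/-- The "plus" Arıkan transform `W⁺(y₁,y₂,u₁|u₂) = (1/q) W(y₁|u₁+u₂) W(y₂|u₂)`;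
the output `(y₁, y₂, u₁)` is encoded as `((y₁, y₂), u₁)`. -/
def plusChannel {G : Type*} [AddCommGroup G] [Fintype G] {Y : Type*}
    (W : G → Y → ℝ) : G → (Y × Y) × G → ℝ :=
  fun u₂ z => (1 / (Fintype.card G : ℝ)) * W (z.2 + u₂) z.1.1 * W u₂ z.1.2

/-- `W` is degraded from `W'`: `W` is obtained from `W'` by composing with a channel `V`. -/
def DegradedFrom {X : Type*} {Y Y' : Type*} [Fintype Y] [Fintype Y'] (W : X → Y → ℝ)
    (W' : X → Y' → ℝ) : Prop :=
  ∃ V : Y' → Y → ℝ, IsChannel V ∧ ∀ x y, W x y = ∑ y' : Y', W' x y' * V y' y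

/-- Channel equivalence: mutual degradation. -/
def EquivalentChannels {X : Type*} {Y Y' : Type*} [Fintype Y] [Fintype Y'] (W : X → Y → ℝ)
    (W' : X → Y' → ℝ) : Prop :=
  DegradedFrom W W' ∧ DegradedFrom W' W

/-- The erasure channel of input alphabet `A` and parameter `ε`; the output alphabet is
`A ∪ {e}`, modelled as `Option A` with `none` as the erasure symbol `e`. For `A = G` this is
the `q`-ary erasure channel `qEC(ε)`. -/
def erasureChannel (A : Type*) (ε : ℝ) : A → Option A → ℝ :=
  fun x y => match y with
    | some z => if z = x then 1 - ε else 0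
    | none => ε

/-- `W : G → Y → ℝ` is a generalized `q`-symmetric channel. -/
def IsGeneralizedSymmetric {G : Type u} [Fintype G] {Y : Type v} [Fintype Y]
    (W : G → Y → ℝ) : Prop :=
  ∃ (Z : Type v) (_ : Fintype Z) (π : G × Z ≃ Y) (p : Z → ℝ) (ε : Z → ℝ),
    (∀ z, 0 ≤ p z) ∧ (∑ z, p z = 1) ∧
    (∀ z, 0 ≤ ε z) ∧ (∀ z, ε z ≤ 1 / ((Fintype.card G : ℝ) - 1)) ∧
    ∀ x x' z, W x (π (x', z)) =
      if x' = x then p z * (1 - ((Fintype.card G : ℝ) - 1) * ε z) else p z * ε z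

/-- `W` is automorphic-symmetric with respect to `(G,+)`: for every automorphism `f` of `G`
there is a bijection `π_f` of the output alphabet with `W(π_f(y)|f(x)) = W(y|x)`. -/
def IsAutSymmetric {G : Type*} [AddCommGroup G] {Y : Type*} (W : G → Y → ℝ) : Prop :=
  ∀ f : G ≃+ G, ∃ π : Y ≃ Y, ∀ x y, W (f x) (π y) = W x y

/-- A channel with input alphabet `G`, packaged with its (finite) output alphabet. -/
structure Channel (G : Type u) where
  Out : Type u
  [fin : Fintype Out]
  prob : G → Out → ℝ

attribute [instance] Channel.fin

def Channel.minus {G : Type u} [AddCommGroup G] [Fintype G] (C : Channel G) : Channel G :=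
  ⟨C.Out × C.Out, minusChannel C.prob⟩

def Channel.plus {G : Type u} [AddCommGroup G] [Fintype G] (C : Channel G) : Channel G :=
  ⟨(C.Out × C.Out) × G, plusChannel C.prob⟩

/-- `C.polar s` is the synthetic channel `W^s`, where `false` encodes `-`, `true` encodes `+`,
and the head of the list is the first transform applied. -/
def Channel.polar {G : Type u} [AddCommGroup G] [Fintype G] (C : Channel G) :
    List Bool → Channel G
  | [] => C
  | b :: s => (cond b C.plus C.minus).polar s

/-- `C` `𝓗`-polarizes: for every `δ > 0`, the fraction of `s ∈ {−,+}ⁿ` such that `W^s` is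
`δ`-determined by some subgroup in `𝓗` tends to `1` as `n → ∞`. Taking `𝓗` to be the set of
all subgroups gives the background (multilevel) polarization property. -/
def Polarizes {G : Type u} [AddCommGroup G] [Fintype G] (C : Channel G)
    (𝓗 : Set (AddSubgroup G)) : Prop :=
  ∀ δ > (0 : ℝ), Filter.Tendsto
    (fun n : ℕ => ((Finset.univ.filter (fun s : Fin n → Bool =>
        ∃ H ∈ 𝓗, DeterminedBy (C.polar (List.ofFn s)).prob H δ)).card : ℝ) / 2 ^ n)
    Filter.atTop (nhds 1)

/-- Erasure structure: the output symbols split into erasures (in `E`, of total mass `e`), which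
carry no information about the input, and symbols that determine the input. -/
structure IsErasing {X Y : Type*} [Fintype Y] (W : X → Y → ℝ) (E : Y → Prop) (e : ℝ) : Prop where
  isChannel : IsChannel W
  const : ∀ y, E y → ∀ x x', W x y = W x' y
  unique : ∀ y, ¬ E y → ∀ x x', W x y ≠ 0 → W x' y ≠ 0 → x = x'
  mass : ∀ x, ∑ y, (if E y then W x y else 0) = e

theorem IsErasing.compl_mass {X Y : Type*} [Fintype Y] {W : X → Y → ℝ} {E : Y → Prop} {e : ℝ}
    (h : IsErasing W E e) (x : X) : ∑ y, (if E y then 0 else W x y) = 1 - e := by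
  rw [← h.mass x, ← h.isChannel.2 x, ← Finset.sum_sub_distrib]
  refine Finset.sum_congr rfl fun y _ => ?_
  split_ifs <;> simp

theorem IsErasing.mem_Icc {X Y : Type*} [Nonempty X] [Fintype Y] {W : X → Y → ℝ} {E : Y → Prop}
    {e : ℝ} (h : IsErasing W E e) : e ∈ Set.Icc (0 : ℝ) 1 := by
  obtain ⟨x⟩ := ‹Nonempty X›
  constructor
  · rw [← h.mass x]
    refine Finset.sum_nonneg fun y _ => ?_
    split_ifs
    exacts [h.isChannel.1 x y, le_rfl]
  · rw [← sub_nonneg, ← h.compl_mass x]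
    refine Finset.sum_nonneg fun y _ => ?_
    split_ifs
    exacts [le_rfl, h.isChannel.1 x y]

theorem IsErasing.capacity_eq {X Y : Type*} [Fintype X] [Nonempty X] [Fintype Y] {W : X → Y → ℝ}
    {E : Y → Prop} {e : ℝ} (h : IsErasing W E e) :
    capacity W = (1 - e) * Real.log (Fintype.card X) := by
  have hX : (Fintype.card X : ℝ) ≠ 0 := by positivity
  have key : ∀ x y, (1 / (Fintype.card X : ℝ)) * W x y *
      Real.log (W x y / ((1 / (Fintype.card X : ℝ)) * ∑ x' : X, W x' y)) =
      (1 / (Fintype.card X : ℝ)) * Real.log (Fintype.card X) * (if E y then 0 else W x y) := by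
    intro x y
    by_cases h0 : W x y = 0
    · simp [h0]
    split_ifs with hE
    · have : ∑ x' : X, W x' y = Fintype.card X * W x y := by
        rw [Finset.sum_congr rfl fun x' _ => h.const y hE x' x]
        simp
      rw [this, ← mul_assoc, one_div_mul_cancel hX, one_mul, div_self h0]
      simp
    · have : ∑ x' : X, W x' y = W x y := by
        refine Finset.sum_eq_single x (fun x' _ hne => ?_) (by simp)
        by_contra h1
        exact hne (h.unique y hE x' x h1 h0)
      rw [this]
      have : W x y / (1 / (Fintype.card X : ℝ) * W x y) = Fintype.card X := by
        field_simp
      rw [this]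
      ring
  unfold capacity
  simp_rw [key]
  rw [Finset.sum_comm]
  simp_rw [← Finset.mul_sum, h.compl_mass]
  simp
  field_simp

theorem quotientChannel_eq_of_const {G : Type*} [AddCommGroup G] [Fintype G] {Y : Type*}
    {W : G → Y → ℝ} (H : AddSubgroup G) (A : G ⧸ H) {y : Y} {c : ℝ} (hc : ∀ x, W x y = c) : quotientChannel H W A y = c := by
  have hcard : ∑ x : G, (if (x : G ⧸ H) = A then (1 : ℝ) else 0) = Nat.card H := by
    obtain ⟨a, rfl⟩ := QuotientAddGroup.mk_surjective A
    rw [Finset.sum_boole, Nat.card_eq_fintype_card]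
    norm_cast
    rw [← Finset.card_univ]
    symm
    refine Finset.card_bij (fun k _ => a + (k : G)) (fun k _ => ?_) (fun k _ l _ hkl => ?_)
      fun x hx => ?_
    · simp
    · exact Subtype.ext (add_left_cancel hkl)
    · have hx' : (x : G ⧸ H) = a := by simpa using hx
      exact ⟨⟨-a + x, QuotientAddGroup.eq.1 hx'.symm⟩, Finset.mem_univ _, by simp⟩
  have hH : (Nat.card H : ℝ) ≠ 0 := by
    have : Nat.card H ≠ 0 := Nat.card_pos.ne'
    exact_mod_cast this
  have : ∀ x : G, (if (x : G ⧸ H) = A then W x y else 0) =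
      (if (x : G ⧸ H) = A then (1 : ℝ) else 0) * c := by
    intro x
    split_ifs <;> simp [hc]
  rw [quotientChannel]
  simp_rw [this]
  rw [← Finset.sum_mul, hcard, ← mul_assoc, one_div_mul_cancel hH, one_mul]

section Transforms

variable {G : Type*} [AddCommGroup G] [Fintype G] {Y : Type*} [Fintype Y] {W : G → Y → ℝ}
  {E : Y → Prop} {e : ℝ}

theorem IsChannel.minus (h : IsChannel W) : IsChannel (minusChannel W) := by
  refine ⟨fun u y => ?_, fun u => ?_⟩
  · exact mul_nonneg (by positivity)
      (Finset.sum_nonneg fun v _ => mul_nonneg (h.1 _ _) (h.1 _ _))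
  · simp only [minusChannel]
    rw [← Finset.mul_sum, Finset.sum_comm]
    simp_rw [Fintype.sum_prod_type, ← Finset.mul_sum, h.2, mul_one, h.2]
    simp

theorem IsChannel.plus (h : IsChannel W) : IsChannel (plusChannel W) := by
  refine ⟨fun u y => ?_, fun u => ?_⟩
  · exact mul_nonneg (mul_nonneg (by positivity) (h.1 _ _)) (h.1 _ _)
  · simp only [plusChannel]
    rw [Fintype.sum_prod_type_right]
    simp_rw [Fintype.sum_prod_type, ← Finset.mul_sum, h.2, mul_one, ← Finset.mul_sum, h.2]
    simp

theorem IsErasing.minus (h : IsErasing W E e) :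
    IsErasing (minusChannel W) (fun y => E y.1 ∨ E y.2) (1 - (1 - e) ^ 2) := by
  refine ⟨h.isChannel.minus, ?_, ?_, fun u => ?_⟩
  · rintro ⟨y₁, y₂⟩ hE u u'
    simp only [minusChannel]
    congr 1
    rcases hE with hE | hE
    · exact Finset.sum_congr rfl fun v _ => by rw [h.const y₁ hE (u + v) (u' + v)]
    · simp_rw [fun v => h.const y₂ hE v 0, ← Finset.sum_mul]
      have shift : ∀ w : G, ∑ v, W (w + v) y₁ = ∑ x, W x y₁ := fun w =>
        Equiv.sum_comp (Equiv.addLeft w) fun x => W x y₁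
      rw [shift, shift]
  · rintro ⟨y₁, y₂⟩ hE u u' hu hu'
    obtain ⟨h₁, h₂⟩ := not_or.1 hE
    obtain ⟨v, -, hv⟩ := Finset.exists_ne_zero_of_sum_ne_zero (right_ne_zero_of_mul hu)
    obtain ⟨v', -, hv'⟩ := Finset.exists_ne_zero_of_sum_ne_zero (right_ne_zero_of_mul hu')
    obtain rfl := h.unique y₂ h₂ v v' (right_ne_zero_of_mul hv) (right_ne_zero_of_mul hv')
    exact add_right_cancel
      (h.unique y₁ h₁ _ _ (left_ne_zero_of_mul hv) (left_ne_zero_of_mul hv'))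
  · have key : ∑ y : Y × Y, (if E y.1 ∨ E y.2 then 0 else minusChannel W u y) = (1 - e) ^ 2 := by
      have : ∀ y : Y × Y, (if E y.1 ∨ E y.2 then 0 else minusChannel W u y) =
          (1 / (Fintype.card G : ℝ)) * ∑ v : G, (if E y.1 then 0 else W (u + v) y.1) *
            (if E y.2 then 0 else W v y.2) := by
        intro y
        by_cases h₁ : E y.1 <;> by_cases h₂ : E y.2 <;> simp [h₁, h₂, minusChannel]
      simp_rw [this]
      rw [← Finset.mul_sum, Finset.sum_comm]
      simp_rw [Fintype.sum_prod_type, ← Finset.mul_sum, h.compl_mass, ← Finset.sum_mul,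
        h.compl_mass]
      simp
      field_simp
    rw [← key, ← h.isChannel.minus.2 u, ← Finset.sum_sub_distrib]
    refine Finset.sum_congr rfl fun y _ => ?_
    split_ifs <;> simp

theorem IsErasing.plus (h : IsErasing W E e) :
    IsErasing (plusChannel W) (fun z => E z.1.1 ∧ E z.1.2) (e ^ 2) := by
  refine ⟨h.isChannel.plus, ?_, ?_, fun u => ?_⟩
  · rintro ⟨⟨y₁, y₂⟩, t⟩ ⟨h₁, h₂⟩ u u'
    simp only [plusChannel]
    rw [h.const y₁ h₁ (t + u) (t + u'), h.const y₂ h₂ u u']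
  · rintro ⟨⟨y₁, y₂⟩, t⟩ hE u u' hu hu'
    by_cases h₁ : E y₁
    · exact h.unique y₂ (fun h₂ => hE ⟨h₁, h₂⟩) u u' (right_ne_zero_of_mul hu)
        (right_ne_zero_of_mul hu')
    · exact add_left_cancel (h.unique y₁ h₁ _ _ (right_ne_zero_of_mul (left_ne_zero_of_mul hu))
        (right_ne_zero_of_mul (left_ne_zero_of_mul hu')))
  · trans ∑ z : (Y × Y) × G, (1 / (Fintype.card G : ℝ)) *
        ((if E z.1.1 then W (z.2 + u) z.1.1 else 0) * (if E z.1.2 then W u z.1.2 else 0))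
    · refine Finset.sum_congr rfl fun z _ => ?_
      by_cases h₁ : E z.1.1 <;> by_cases h₂ : E z.1.2 <;> simp [h₁, h₂, plusChannel, mul_assoc]
    · rw [← Finset.mul_sum, Fintype.sum_prod_type_right]
      simp_rw [Fintype.sum_prod_type, ← Finset.mul_sum, h.mass, ← Finset.sum_mul, h.mass]
      simp
      field_simp

theorem sum_quotientChannel (H : AddSubgroup G) (A : G ⧸ H) (W : G → Y → ℝ) :
    ∑ y, quotientChannel H W A y =
      quotientChannel H (fun x (_ : Unit) => ∑ y, W x y) A () := by
  simp only [quotientChannel]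
  rw [← Finset.mul_sum, Finset.sum_comm]
  congr 1
  refine Finset.sum_congr rfl fun x _ => ?_
  split_ifs <;> simp

theorem IsErasing.quotient (h : IsErasing W E e) (H : AddSubgroup G) :
    IsErasing (quotientChannel H W) E e := by
  refine ⟨⟨fun A y => ?_, fun A => ?_⟩, fun y hE A A' => ?_, fun y hE A A' hA hA' => ?_,
    fun A => ?_⟩
  · refine mul_nonneg (by positivity) (Finset.sum_nonneg fun x _ => ?_)
    split_ifs
    exacts [h.isChannel.1 x y, le_rfl]
  · rw [sum_quotientChannel]
    exact quotientChannel_eq_of_const H A h.isChannel.2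
  · rw [quotientChannel_eq_of_const H A fun x => h.const y hE x 0,
      quotientChannel_eq_of_const H A' fun x => h.const y hE x 0]
  · obtain ⟨x, -, hx⟩ := Finset.exists_ne_zero_of_sum_ne_zero (right_ne_zero_of_mul hA)
    obtain ⟨x', -, hx'⟩ := Finset.exists_ne_zero_of_sum_ne_zero (right_ne_zero_of_mul hA')
    rw [ite_ne_right_iff] at hx hx'
    rw [← hx.1, ← hx'.1, h.unique y hE x x' hx.2 hx'.2]
  · have : ∀ y, (if E y then quotientChannel H W A y else 0) =
        quotientChannel H (fun x y => if E y then W x y else 0) A y := by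
      intro y
      by_cases hE : E y <;> simp [hE, quotientChannel]
    simp_rw [this]
    rw [sum_quotientChannel]
    exact quotientChannel_eq_of_const H A h.mass

/-- An erasing channel can only be determined, with enough precision, by a trivial subgroup. -/
theorem IsErasing.eq_bot_or_eq_top (h : IsErasing W E e) {H : AddSubgroup G} {δ : ℝ}
    (hδ : δ ≤ Real.log 2 / 3) (hH : DeterminedBy W H δ) : H = ⊥ ∨ H = ⊤ := by
  by_contra! hne
  obtain ⟨h₁, h₂⟩ := hH
  rw [h.capacity_eq] at h₁
  rw [(h.quotient H).capacity_eq, ← Nat.card_eq_fintype_card] at h₂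
  rw [← Nat.card_eq_fintype_card, AddSubgroup.card_eq_card_quotient_mul_card_addSubgroup H] at h₁
  have hB : 1 < Nat.card H := (AddSubgroup.one_lt_card_iff_ne_bot H).2 hne.1
  have hT : 1 < Nat.card (G ⧸ H) := by
    have h1 : Nat.card (G ⧸ H) ≠ 1 := fun h1 => hne.2 (AddSubgroup.index_eq_one.1 h1)
    have h2 : 0 < Nat.card (G ⧸ H) := Nat.card_pos
    omega
  have hB' : Real.log 2 ≤ Real.log (Nat.card H) :=
    Real.log_le_log (by norm_num) (by exact_mod_cast hB)
  have hT' : Real.log 2 ≤ Real.log (Nat.card (G ⧸ H)) :=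
    Real.log_le_log (by norm_num) (by exact_mod_cast hT)
  have hlog : Real.log ((Nat.card (G ⧸ H) * Nat.card H : ℕ) : ℝ) =
      Real.log (Nat.card (G ⧸ H)) + Real.log (Nat.card H) := by
    push_cast
    exact Real.log_mul (by positivity) (by positivity)
  rw [hlog] at h₁
  rw [abs_lt] at h₁ h₂
  obtain ⟨he0, he1⟩ := h.mem_Icc
  nlinarith [mul_le_mul_of_nonneg_left hB' (sub_nonneg.2 he1), mul_le_mul_of_nonneg_left hT' he0]

end Transforms

theorem DeterminedBy.mono {G : Type*} [AddCommGroup G] [Fintype G] {Y : Type*} [Fintype Y]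
    {W : G → Y → ℝ} {H : AddSubgroup G} {δ δ' : ℝ} (h : DeterminedBy W H δ) (hδ : δ ≤ δ') :
    DeterminedBy W H δ' :=
  ⟨h.1.trans_le hδ, h.2.trans_le hδ⟩

theorem EquivalentChannels.exists_isErasing {X Y : Type*} [Fintype X] [Nontrivial X] [Fintype Y]
    {W : X → Y → ℝ} {ε : ℝ} (hW : IsChannel W) (hε0 : 0 ≤ ε) (hε1 : ε ≤ 1)
    (h : EquivalentChannels W (erasureChannel X ε)) : ∃ E : Y → Prop, IsErasing W E ε := by
  obtain ⟨⟨V, hV, hWV⟩, U, hU, hUW⟩ := h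
  set c : Y → ℝ := fun y => ε * V none y with hc
  have hcW : ∀ x y, c y ≤ W x y := by
    intro x y
    rw [hWV, Fintype.sum_option]
    refine le_add_of_nonneg_right (Finset.sum_nonneg fun z _ => mul_nonneg ?_ (hV.1 _ _))
    simp only [erasureChannel]
    split_ifs <;> linarith
  have hc0 : ∀ y, 0 ≤ c y := fun y => mul_nonneg hε0 (hV.1 _ _)
  have hcsum : ∑ y, c y = ε := by rw [← Finset.mul_sum, hV.2, mul_one]
  set S : X → Y → Prop := fun x y => ∀ x', x' ≠ x → W x' y = 0 with hS
  have hUS : ∀ x y, ¬ S x y → U y (some x) = 0 := by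
    intro x y hxy
    simp only [hS, not_forall] at hxy
    obtain ⟨x', hne, h0⟩ := hxy
    have hsum := hUW x' (some x)
    simp only [erasureChannel, if_neg hne.symm] at hsum
    have := (Finset.sum_eq_zero_iff_of_nonneg
      (fun y _ => mul_nonneg (hW.1 x' y) (hU.1 y (some x)))).1 hsum.symm y (Finset.mem_univ _)
    exact (mul_eq_zero.1 this).resolve_left h0
  have hU1 : ∀ y z, U y z ≤ 1 := fun y z =>
    (Finset.single_le_sum (fun z _ => hU.1 y z) (Finset.mem_univ z)).trans_eq (hU.2 y)
  have hcS : ∀ x y, S x y → c y = 0 := by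
    intro x y hxy
    obtain ⟨x', hne⟩ := exists_ne x
    exact le_antisymm ((hcW x' y).trans_eq (hxy x' hne)) (hc0 y)
  have hmass : ∀ x, 1 - ε ≤ ∑ y, (if S x y then W x y else 0) := by
    intro x
    have hsum := hUW x (some x)
    simp only [erasureChannel, if_true] at hsum
    rw [hsum]
    refine Finset.sum_le_sum fun y _ => ?_
    split_ifs with hxy
    · exact mul_le_of_le_one_right (hW.1 x y) (hU1 _ _)
    · rw [hUS x y hxy, mul_zero]
  have hEq : ∀ x y, ¬ S x y → W x y = c y := by
    intro x
    have hle : ∀ y ∈ Finset.univ, c y ≤ (if S x y then 0 else W x y) := by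
      intro y _
      split_ifs with hxy
      exacts [(hcS x y hxy).le, hcW x y]
    have hsum : ∑ y, c y = ∑ y, (if S x y then 0 else W x y) := by
      refine le_antisymm (Finset.sum_le_sum hle) ?_
      have : ∑ y, (if S x y then 0 else W x y) + ∑ y, (if S x y then W x y else 0) = 1 := by
        rw [← hW.2 x, ← Finset.sum_add_distrib]
        refine Finset.sum_congr rfl fun y _ => ?_
        split_ifs <;> simp
      linarith [hmass x]
    intro y hxy
    have := (Finset.sum_eq_sum_iff_of_le hle).1 hsum y (Finset.mem_univ _)
    rw [this, if_neg hxy]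
  refine ⟨fun y => ∀ x, ¬ S x y, hW, fun y hE x x' => ?_, fun y hE x x' hx hx' => ?_, fun x => ?_⟩
  · rw [hEq x y (hE x), hEq x' y (hE x')]
  · simp only [not_forall, not_not] at hE
    obtain ⟨a, ha⟩ := hE
    have key : ∀ b, W b y ≠ 0 → b = a := fun b hb => by
      by_contra hne
      exact hb (ha b hne)
    rw [key x hx, key x' hx']
  · rw [← hcsum]
    refine Finset.sum_congr rfl fun y _ => ?_
    split_ifs with hE
    · exact hEq x y (hE x)
    · simp only [not_forall, not_not] at hE
      obtain ⟨a, ha⟩ := hE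
      exact (hcS a y ha).symm

theorem Channel.exists_isErasing_polar {G : Type u} [AddCommGroup G] [Fintype G] (s : List Bool) :
    ∀ C : Channel G, (∃ E e, IsErasing C.prob E e) → ∃ E e, IsErasing (C.polar s).prob E e := by
  induction s with
  | nil => exact fun C h => h
  | cons b s ih =>
    rintro C ⟨E, e, h⟩
    refine ih _ ?_
    cases b
    exacts [⟨_, _, h.minus⟩, ⟨_, _, h.plus⟩]

theorem Polarizes.tendsto_of_imp {G : Type u} [AddCommGroup G] [Fintype G] {C : Channel G}
    {𝓗 : Set (AddSubgroup G)} (h : Polarizes C 𝓗) {δ : ℝ} (hδ : 0 < δ) {P : List Bool → Prop}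
    [DecidablePred P] (hP : ∀ s, ∀ H ∈ 𝓗, DeterminedBy (C.polar s).prob H δ → P s) :
    Filter.Tendsto (fun n : ℕ => ((Finset.univ.filter (fun s : Fin n → Bool =>
      P (List.ofFn s))).card : ℝ) / 2 ^ n) Filter.atTop (nhds 1) := by
  refine tendsto_of_tendsto_of_tendsto_of_le_of_le (h δ hδ) tendsto_const_nhds
    (fun n => ?_) fun n => ?_
  · refine div_le_div_of_nonneg_right ?_ (by positivity)
    refine Nat.cast_le.2 (Finset.card_le_card (Finset.monotone_filter_right _ ?_))
    rintro s - ⟨H, hH, hdet⟩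
    exact hP _ H hH hdet
  · refine div_le_one_of_le₀ ?_ (by positivity)
    refine (Nat.cast_le.2 (Finset.card_filter_le _ _)).trans_eq ?_
    simp

/-- every `q`-ary erasure channel (satisfying the background polarization
property) strongly polarizes. -/
theorem stmt_6 {G : Type u} [AddCommGroup G] [Fintype G] (hq : 2 ≤ Fintype.card G)
    (ε : ℝ) (hε0 : 0 ≤ ε) (hε1 : ε ≤ 1)
    (C : Channel G) (hC : IsChannel C.prob)
    (hequiv : EquivalentChannels C.prob (erasureChannel G ε))
    (hbg : Polarizes C Set.univ) :
    ∀ δ > (0 : ℝ), Filter.Tendsto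
      (fun n : ℕ => ((Finset.univ.filter (fun s : Fin n → Bool =>
          DeterminedBy (C.polar (List.ofFn s)).prob (⊥ : AddSubgroup G) δ ∨
          DeterminedBy (C.polar (List.ofFn s)).prob (⊤ : AddSubgroup G) δ)).card : ℝ) / 2 ^ n)
      Filter.atTop (nhds 1) := by
  intro δ hδ
  have : Nontrivial G := Fintype.one_lt_card_iff_nontrivial.1 hq
  obtain ⟨E, hE⟩ := hequiv.exists_isErasing hC hε0 hε1
  have hδ' : 0 < min δ (Real.log 2 / 3) :=
    lt_min hδ (div_pos (Real.log_pos (by norm_num)) (by norm_num))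
  refine hbg.tendsto_of_imp (P := fun s => DeterminedBy (C.polar s).prob (⊥ : AddSubgroup G) δ ∨
    DeterminedBy (C.polar s).prob (⊤ : AddSubgroup G) δ) hδ' fun s H _ hH => ?_
  obtain ⟨E', e', h'⟩ := C.exists_isErasing_polar s ⟨E, ε, hE⟩
  rcases h'.eq_bot_or_eq_top (min_le_right _ _) hH with rfl | rfl
  · exact Or.inl (hH.mono (min_le_left _ _))
  · exact Or.inr (hH.mono (min_le_left _ _))

end
end

section
/- Let (G,+) be a finite Abelian group with |G| = q and set δ₀ = (log 2)/3. If W : G → 𝒴 is an automorphic-symmetric channel and H is a subgroup of G that is not characteristic (i.e., f(H) ≠ H for some automorphism f of G), then W is not δ₀-determined by H. -/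
open scoped Classical

noncomputable section

universe u v

/-- The sum of `p` over the coset `x + H`. -/
def cosetSum {G : Type*} [AddCommGroup G] [Fintype G] (H : AddSubgroup G) (p : G → ℝ) (x : G) :
    ℝ :=
  ∑ a : G, if -x + a ∈ H then p a else 0

theorem le_cosetSum {G : Type*} [AddCommGroup G] [Fintype G] (H : AddSubgroup G) {p : G → ℝ}
    (hp : ∀ x, 0 ≤ p x) (x : G) : p x ≤ cosetSum H p x := by
  unfold cosetSum
  have h := Finset.single_le_sum (f := fun a => if -x + a ∈ H then p a else 0)
    (fun a _ => by split_ifs <;> simp [hp]) (Finset.mem_univ x)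
  simpa using h

theorem cosetSum_map {G : Type*} [AddCommGroup G] [Fintype G] (H : AddSubgroup G) (f : G ≃+ G)
    (p : G → ℝ) (x : G) :
    cosetSum (H.map f.toAddMonoidHom) p (f x) = cosetSum H (fun a => p (f a)) x := by
  unfold cosetSum
  rw [← Equiv.sum_comp f.toEquiv]
  refine Finset.sum_congr rfl fun a _ => ?_
  have h : -f x + f a ∈ H.map f.toAddMonoidHom ↔ -x + a ∈ H := by
    rw [← map_neg, ← map_add]
    exact AddSubgroup.mem_map_iff_mem f.injective
  exact if_congr h rfl rfl

/-- Two cosets of `H` and `K` meet in at most `|H ⊓ K|` points. -/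
theorem card_inter_cosets_le {G : Type*} [AddCommGroup G] [Fintype G] (H K : AddSubgroup G)
    (a b : G) :
    (Finset.univ.filter fun x : G => -x + a ∈ H ∧ -x + b ∈ K).card
      ≤ Nat.card (H ⊓ K : AddSubgroup G) := by
  rcases Finset.eq_empty_or_nonempty
    (Finset.univ.filter fun x : G => -x + a ∈ H ∧ -x + b ∈ K) with h | ⟨z, hz⟩
  · simp [h]
  · rw [Nat.card_eq_fintype_card, ← Finset.card_univ,
      ← Finset.card_map (Function.Embedding.subtype _)]
    refine Finset.card_le_card_of_injOn (fun x => -x + z) (fun x hx => ?_)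
      (fun x _ x' _ h => by simpa using h)
    simp only [Finset.coe_filter, Finset.mem_filter, Finset.mem_univ, true_and,
      Set.mem_ofPred_eq] at hx hz
    have h₁ := H.sub_mem hx.1 hz.1
    have h₂ := K.sub_mem hx.2 hz.2
    rw [show -x + a - (-z + a) = -x + z by abel] at h₁
    rw [show -x + b - (-z + b) = -x + z by abel] at h₂
    simpa using ⟨h₁, h₂⟩

theorem sum_cosetSum_mul_le {G : Type*} [AddCommGroup G] [Fintype G] (H K : AddSubgroup G)
    {p : G → ℝ} (hp : ∀ x, 0 ≤ p x) :
    ∑ x, cosetSum H p x * cosetSum K p x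
      ≤ Nat.card (H ⊓ K : AddSubgroup G) * (∑ x, p x) ^ 2 := by
  have key : ∑ x, cosetSum H p x * cosetSum K p x = ∑ a, ∑ b,
      ((Finset.univ.filter fun x : G => -x + a ∈ H ∧ -x + b ∈ K).card : ℝ) * (p a * p b) := by
    simp only [cosetSum, Finset.sum_mul_sum]
    rw [Finset.sum_comm]
    refine Finset.sum_congr rfl fun a _ => ?_
    rw [Finset.sum_comm]
    refine Finset.sum_congr rfl fun b _ => ?_
    rw [← nsmul_eq_mul, ← Finset.sum_const, Finset.sum_filter]
    refine Finset.sum_congr rfl fun x _ => ?_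
    by_cases h₁ : -x + a ∈ H <;> by_cases h₂ : -x + b ∈ K <;> simp [h₁, h₂]
  rw [key, sq, Finset.sum_mul_sum, Finset.mul_sum]
  refine Finset.sum_le_sum fun a _ => ?_
  rw [Finset.mul_sum]
  refine Finset.sum_le_sum fun b _ => ?_
  exact mul_le_mul_of_nonneg_right (by exact_mod_cast card_inter_cosets_le H K a b)
    (mul_nonneg (hp a) (hp b))

/-- Per-output form of the bound `H(X mod H ⊓ K) ≤ H(X mod H) + H(X mod K)`. -/
theorem sum_mul_log_cosetSum_le {G : Type*} [AddCommGroup G] [Fintype G] (H K : AddSubgroup G)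
    {p : G → ℝ} (hp : ∀ x, 0 ≤ p x) :
    ∑ x, p x * (Real.log (cosetSum H p x / Nat.card H / ((1 / Fintype.card G) * ∑ a, p a))
        + Real.log (cosetSum K p x / Nat.card K / ((1 / Fintype.card G) * ∑ a, p a))
        + Real.log (Nat.card H * Nat.card K /
            (Nat.card (H ⊓ K : AddSubgroup G) * Fintype.card G)))
      ≤ ∑ x, p x * Real.log (p x / ((1 / Fintype.card G) * ∑ a, p a)) := by
  set S := ∑ a, p a with hS
  have hS0 : 0 ≤ S := Finset.sum_nonneg fun x _ => hp x
  rcases hS0.eq_or_lt with h0 | hSpos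
  · have : ∀ x, p x = 0 := fun x =>
      (Finset.sum_eq_zero_iff_of_nonneg fun x _ => hp x).1 (hS ▸ h0.symm) x (Finset.mem_univ x)
    simp [this]
  have hH : (0 : ℝ) < Nat.card H := by exact_mod_cast Nat.card_pos
  have hK : (0 : ℝ) < Nat.card K := by exact_mod_cast Nat.card_pos
  have hM : (0 : ℝ) < Nat.card (H ⊓ K : AddSubgroup G) := by exact_mod_cast Nat.card_pos
  have hq : (0 : ℝ) < Fintype.card G := by exact_mod_cast Fintype.card_pos
  generalize hm : (Nat.card (H ⊓ K : AddSubgroup G) : ℝ) = m at *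
  generalize (Nat.card H : ℝ) = h at *
  generalize (Nat.card K : ℝ) = k at *
  generalize (Fintype.card G : ℝ) = q at *
  have hsum : ∑ x, (p x - cosetSum H p x * cosetSum K p x / (m * S)) ≥ 0 := by
    rw [Finset.sum_sub_distrib, ← Finset.sum_div, ← hS, ge_iff_le, sub_nonneg,
      div_le_iff₀ (by positivity)]
    have := sum_cosetSum_mul_le H K hp
    rw [hm, ← hS] at this
    nlinarith
  rw [← sub_nonneg, ← Finset.sum_sub_distrib]
  refine hsum.le.trans (Finset.sum_le_sum fun x _ => ?_)
  have hHx := le_cosetSum H hp x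
  have hKx := le_cosetSum K hp x
  generalize cosetSum H p x = u at *
  generalize cosetSum K p x = v at *
  rcases (hp x).eq_or_lt with h0 | hx
  · rw [← h0] at hHx hKx ⊢
    have : 0 ≤ u * v / (m * S) := by positivity
    linarith
  · have hu : 0 < u := hx.trans_le hHx
    have hv : 0 < v := hx.trans_le hKx
    have hlog : Real.log (p x / (1 / q * S)) - (Real.log (u / h / (1 / q * S))
        + Real.log (v / k / (1 / q * S)) + Real.log (h * k / (m * q)))
        = Real.log (p x * S * m / (u * v)) := by
      rw [← Real.log_mul (by positivity) (by positivity),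
        ← Real.log_mul (by positivity) (by positivity),
        ← Real.log_div (by positivity) (by positivity)]
      congr 1
      field_simp
    have h1 := Real.one_sub_inv_le_log_of_pos (show 0 < p x * S * m / (u * v) by positivity)
    rw [← mul_sub, hlog]
    refine le_trans (le_of_eq ?_) (mul_le_mul_of_nonneg_left h1 hx.le)
    field_simp

theorem capacity_quotientChannel {G : Type*} [AddCommGroup G] [Fintype G] {Y : Type*} [Fintype Y]
    (H : AddSubgroup G) (W : G → Y → ℝ) :
    capacity (quotientChannel H W) = ∑ y, ∑ x, (1 / (Fintype.card G : ℝ)) * W x y *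
      Real.log (cosetSum H (fun a => W a y) x / Nat.card H /
        ((1 / Fintype.card G) * ∑ a, W a y)) := by
  have hcard : (Fintype.card G : ℝ) = Fintype.card (G ⧸ H) * Nat.card H := by
    have := AddSubgroup.card_eq_card_quotient_mul_card_addSubgroup H
    rw [Nat.card_eq_fintype_card, Nat.card_eq_fintype_card (α := G ⧸ H)] at this
    exact_mod_cast this
  have hfib : ∀ (g : G → ℝ) (L : G ⧸ H → ℝ),
      ∑ A : G ⧸ H, (∑ x : G, if (x : G ⧸ H) = A then g x else 0) * L A = ∑ x : G, g x * L x := by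
    intro g L
    simp only [Finset.sum_mul]
    rw [Finset.sum_comm]
    simp [ite_mul]
  unfold capacity quotientChannel
  refine Finset.sum_congr rfl fun y _ => ?_
  have hS : (1 / (Fintype.card (G ⧸ H) : ℝ)) * ∑ A : G ⧸ H,
      (1 / (Nat.card H : ℝ)) * (∑ x : G, if (x : G ⧸ H) = A then W x y else 0)
      = (1 / Fintype.card G) * ∑ a, W a y := by
    have := hfib (fun x => W x y) (fun _ => 1)
    simp only [mul_one] at this
    rw [← Finset.mul_sum, this, hcard]
    ring
  rw [hS]
  have := hfib (fun x => (1 / (Fintype.card G : ℝ)) * W x y)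
    (fun A => Real.log ((1 / (Nat.card H : ℝ)) *
      (∑ x : G, if (x : G ⧸ H) = A then W x y else 0) / ((1 / Fintype.card G) * ∑ a, W a y)))
  calc _ = _ := ?_
    _ = _ := this
    _ = _ := ?_
  · refine Finset.sum_congr rfl fun A _ => ?_
    congr 1
    simp only [← mul_ite_zero, ← Finset.mul_sum]
    rw [hcard]
    ring
  · refine Finset.sum_congr rfl fun x _ => ?_
    have hc : (∑ a : G, if (a : G ⧸ H) = (x : G ⧸ H) then W a y else 0)
        = cosetSum H (fun a => W a y) x := by
      unfold cosetSum
      refine Finset.sum_congr rfl fun a _ => ?_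
      have : (a : G ⧸ H) = (x : G ⧸ H) ↔ -x + a ∈ H := by rw [eq_comm, QuotientAddGroup.eq]
      simp [this]
    simp only [hc]
    rw [one_div_mul_eq_div (Nat.card H : ℝ)]

theorem IsAutSymmetric.capacity_quotientChannel_map {G : Type*} [AddCommGroup G] [Fintype G]
    {Y : Type*} [Fintype Y] {W : G → Y → ℝ} (hsym : IsAutSymmetric W) (H : AddSubgroup G)
    (f : G ≃+ G) :
    capacity (quotientChannel (H.map f.toAddMonoidHom) W) = capacity (quotientChannel H W) := by
  obtain ⟨π, hπ⟩ := hsym f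
  have hcard : Nat.card (H.map f.toAddMonoidHom) = Nat.card H :=
    (Nat.card_congr (H.equivMapOfInjective f.toAddMonoidHom f.injective).toEquiv).symm
  rw [capacity_quotientChannel, capacity_quotientChannel, hcard, ← Equiv.sum_comp π]
  refine Finset.sum_congr rfl fun y _ => ?_
  have hsum : ∑ a, W a (π y) = ∑ a, W a y := by
    rw [← Equiv.sum_comp f.toEquiv]
    exact Finset.sum_congr rfl fun a _ => hπ a y
  rw [← Equiv.sum_comp f.toEquiv, hsum]
  refine Finset.sum_congr rfl fun x _ => ?_
  simp only [AddEquiv.toEquiv_eq_coe, AddEquiv.coe_toEquiv, cosetSum_map, hπ]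

theorem capacity_quotientChannel_add_le {G : Type*} [AddCommGroup G] [Fintype G] {Y : Type*}
    [Fintype Y] {W : G → Y → ℝ} (hW : IsChannel W) (H K : AddSubgroup G) :
    capacity (quotientChannel H W) + capacity (quotientChannel K W)
        + Real.log (Nat.card H * Nat.card K /
            (Nat.card (H ⊓ K : AddSubgroup G) * Fintype.card G))
      ≤ capacity W := by
  have hq : (Fintype.card G : ℝ) ≠ 0 := by exact_mod_cast Fintype.card_ne_zero
  have htot : ∀ L : ℝ, L = ∑ y, ∑ x, (1 / (Fintype.card G : ℝ)) * W x y * L := by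
    intro L
    rw [Finset.sum_comm]
    simp only [← Finset.sum_mul, ← Finset.mul_sum, hW.2]
    simp [hq]
  rw [htot (Real.log (Nat.card H * Nat.card K / _)), capacity_quotientChannel,
    capacity_quotientChannel, capacity]
  simp only [← Finset.sum_add_distrib]
  refine Finset.sum_le_sum fun y _ => ?_
  have := mul_le_mul_of_nonneg_left (sum_mul_log_cosetSum_le H K fun x => hW.1 x y)
    (show 0 ≤ 1 / (Fintype.card G : ℝ) by positivity)
  simp only [Finset.mul_sum (s := (Finset.univ : Finset G)) (a := 1 / (Fintype.card G : ℝ))]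
    at this ⊢
  simpa only [mul_add, mul_assoc] using this

theorem two_mul_card_inf_le {G : Type*} [AddCommGroup G] [Fintype G] {H K : AddSubgroup G}
    (hcard : Nat.card K = Nat.card H) (hne : K ≠ H) :
    2 * Nat.card (H ⊓ K : AddSubgroup G) ≤ Nat.card H := by
  obtain ⟨c, hc⟩ := AddSubgroup.card_dvd_of_le (inf_le_left : H ⊓ K ≤ H)
  have hpos : 0 < Nat.card H := Nat.card_pos
  have hc1 : c ≠ 1 := by
    rintro rfl
    have h₁ : H ⊓ K = H := AddSubgroup.eq_of_le_of_card_ge inf_le_left (by omega)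
    exact hne (AddSubgroup.eq_of_le_of_card_ge (inf_eq_left.1 h₁) hcard.le).symm
  have hc0 : c ≠ 0 := by rintro rfl; omega
  have : 2 ≤ c := by omega
  nlinarith

/-- with `δ₀ = (log 2)/3`, an automorphic-symmetric channel cannot be
`δ₀`-determined by a non-characteristic subgroup. -/
theorem stmt_12 {G : Type*} [AddCommGroup G] [Fintype G] {Y : Type*} [Fintype Y]
    (W : G → Y → ℝ) (hW : IsChannel W) (hsym : IsAutSymmetric W)
    (H : AddSubgroup G) (hnc : ∃ f : G ≃+ G, H.map f.toAddMonoidHom ≠ H) :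
    ¬ DeterminedBy W H (Real.log 2 / 3) := by
  rintro ⟨h₁, h₂⟩
  obtain ⟨f, hf⟩ := hnc
  have hcard : Nat.card (H.map f.toAddMonoidHom) = Nat.card H :=
    (Nat.card_congr (H.equivMapOfInjective f.toAddMonoidHom f.injective).toEquiv).symm
  have hle := capacity_quotientChannel_add_le hW H (H.map f.toAddMonoidHom)
  rw [hsym.capacity_quotientChannel_map, hcard] at hle
  have hM := two_mul_card_inf_le hcard hf
  have hG : (Fintype.card G : ℝ) = Nat.card (G ⧸ H) * Nat.card H := by
    have := AddSubgroup.card_eq_card_quotient_mul_card_addSubgroup H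
    rw [Nat.card_eq_fintype_card] at this
    exact_mod_cast this
  have hH0 : (0 : ℝ) < Nat.card H := by exact_mod_cast Nat.card_pos
  have hM0 : (0 : ℝ) < Nat.card (H ⊓ H.map f.toAddMonoidHom : AddSubgroup G) := by
    exact_mod_cast Nat.card_pos
  have hQ0 : (0 : ℝ) < Nat.card (G ⧸ H) := by exact_mod_cast Nat.card_pos
  have hM' : (2 : ℝ) * Nat.card (H ⊓ H.map f.toAddMonoidHom : AddSubgroup G) ≤ Nat.card H := by
    exact_mod_cast hM
  have hlog : Real.log 2 - Real.log (Nat.card (G ⧸ H)) ≤ Real.log (Nat.card H * Nat.card H /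
      (Nat.card (H ⊓ H.map f.toAddMonoidHom : AddSubgroup G) * Fintype.card G)) := by
    rw [← Real.log_div two_ne_zero hQ0.ne']
    refine Real.log_le_log (by positivity) ?_
    rw [hG, div_le_div_iff₀ hQ0 (by positivity)]
    calc _ = (2 * (Nat.card (H ⊓ H.map f.toAddMonoidHom : AddSubgroup G) : ℝ))
          * (Nat.card (G ⧸ H) * Nat.card H) := by ring
      _ ≤ Nat.card H * (Nat.card (G ⧸ H) * Nat.card H) := by gcongr
      _ = _ := by ring
  rw [abs_lt] at h₁ h₂
  linarith [h₁.2, h₂.1]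

end
end
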